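/- Let f : ℝ → ℝ be continuous with compact support, let τ > 0 and β > 0, and let u(τ,x) = (1/(2√(πτ))) ∫_ℝ exp(−(x−ξ)²/(4τ)) f(ξ) dξ. Then for every real x the series ∑_{j=0}^∞ (1/(2√(τ+β))^j) · H_j(x/(2√β)) · (β^{j/2}/j!) · f_j converges to u(τ,x), where f_j = ∫_ℝ (e^{−ξ²/(4(τ+β))} / (2√(π(τ+β)))) · H_j(ξ/(2√(τ+β))) · f(ξ) dξ. -/

import Mathlib

open Real MeasureTheory

/-- The physicists' Hermite polynomial `H_j(z) = (-1)^j e^{z²} (d^j/dz^j) e^{-z²}`. -/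
noncomputable def hermiteH (j : ℕ) (z : ℝ) : ℝ :=
  (-1) ^ j * Real.exp (z ^ 2) * iteratedDeriv j (fun t : ℝ => Real.exp (-t ^ 2)) z

/-- The Taylor coefficients at `0` of `exp (p * w + q * w ^ 2)`. -/
noncomputable def expQuadCoeff (p q : ℝ) (j : ℕ) : ℝ :=
  ∑ kl ∈ Finset.HasAntidiagonal.antidiagonal j, p ^ kl.1 / (kl.1.factorial : ℝ) *
    if Even kl.2 then q ^ (kl.2 / 2) / ((kl.2 / 2).factorial : ℝ) else 0

theorem abs_expQuadCoeff_le (p q : ℝ) (j : ℕ) :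
    |expQuadCoeff p q j| ≤ expQuadCoeff |p| |q| j := by
  refine (Finset.abs_sum_le_sum_abs _ _).trans (Finset.sum_le_sum fun kl _ => le_of_eq ?_)
  split_ifs <;> simp [abs_mul, abs_div, abs_pow]

theorem hasSum_sq_exp {𝕜 : Type*} [RCLike 𝕜] (q : ℝ) (w : 𝕜) :
    HasSum (fun k : ℕ =>
      ((if Even k then q ^ (k / 2) / ((k / 2).factorial : ℝ) else 0 : ℝ) : 𝕜) * w ^ k)
      (NormedSpace.exp ((q : 𝕜) * w ^ 2)) := by
  have hinj : Function.Injective fun m : ℕ => 2 * m := fun a b h => by simpa using h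
  rw [← hinj.hasSum_iff]
  · convert NormedSpace.expSeries_div_hasSum_exp ((q : 𝕜) * w ^ 2) using 2 with m
    simp only [Function.comp, even_two, Even.mul_right, if_true]
    rw [Nat.mul_div_cancel_left _ two_pos]
    push_cast
    ring
  · intro k hk
    rw [if_neg]
    · simp
    · rintro ⟨m, rfl⟩
      exact hk ⟨m, by simp; ring⟩

theorem hasSum_expQuadCoeff {𝕜 : Type*} [RCLike 𝕜] (p q : ℝ) (w : 𝕜) :
    HasSum (fun j : ℕ => (expQuadCoeff p q j : 𝕜) * w ^ j)
      (NormedSpace.exp ((p : 𝕜) * w + (q : 𝕜) * w ^ 2)) := by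
  have h₁ := NormedSpace.expSeries_div_hasSum_exp ((p : 𝕜) * w)
  have h₂ := hasSum_sq_exp q w
  have n₁ := h₁.summable.norm
  have n₂ := h₂.summable.norm
  have hs := (summable_norm_sum_mul_antidiagonal_of_summable_norm n₁ n₂).of_norm.hasSum
  rw [← tsum_mul_tsum_eq_tsum_sum_antidiagonal_of_summable_norm n₁ n₂, h₁.tsum_eq, h₂.tsum_eq,
    ← NormedSpace.exp_add] at hs
  convert! hs using 2 with j
  rw [expQuadCoeff, RCLike.ofReal_sum, Finset.sum_mul]
  refine Finset.sum_congr rfl fun kl hkl => ?_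
  rw [← Finset.HasAntidiagonal.mem_antidiagonal.mp hkl, RCLike.ofReal_mul]
  push_cast
  ring

theorem hermiteH_eq (a : ℝ) (j : ℕ) :
    hermiteH j a = j.factorial * expQuadCoeff (2 * a) (-1) j := by
  have hs : ∀ w : ℝ, HasSum (fun j => w ^ j • expQuadCoeff (2 * a) (-1) j)
      (Real.exp (a ^ 2) * Real.exp (-(a - w) ^ 2)) := by
    intro w
    have h := hasSum_expQuadCoeff (2 * a) (-1) w
    rw [← Real.exp_eq_exp_ℝ] at h
    convert! h using 1
    · ext j; simp [mul_comm]
    · rw [← Real.exp_add]; congr 1; simp; ring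
  have hp : HasFPowerSeriesAt (fun w : ℝ => Real.exp (a ^ 2) * Real.exp (-(a - w) ^ 2))
      (FormalMultilinearSeries.ofScalars ℝ (expQuadCoeff (2 * a) (-1))) 0 := by
    rw [hasFPowerSeriesAt_iff]
    refine Filter.Eventually.of_forall fun w => ?_
    simpa [FormalMultilinearSeries.coeff_ofScalars] using hs w
  obtain ⟨r, hr⟩ := hp
  have h := hr.factorial_smul 1 j
  rw [← iteratedDeriv_eq_iteratedFDeriv, iteratedDeriv_const_mul_field,
    iteratedDeriv_comp_const_sub j (fun t : ℝ => Real.exp (-t ^ 2)) a] at h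
  simp at h
  rw [hermiteH, h]
  ring

open scoped FourierTransform

theorem iteratedDeriv_ofReal {g : ℝ → ℝ} (hg : ContDiff ℝ ⊤ g) (j : ℕ) :
    iteratedDeriv j (fun t => (g t : ℂ)) = fun t => ((iteratedDeriv j g t : ℝ) : ℂ) := by
  induction j with
  | zero => simp
  | succ j ih =>
    ext t
    rw [iteratedDeriv_succ, ih, iteratedDeriv_succ]
    have hd := hg.differentiable_iteratedDeriv j (by exact_mod_cast WithTop.coe_lt_top _)
    exact (hd t).hasDerivAt.ofReal_comp.deriv

theorem integrable_pow_mul_exp_neg_mul_sq {b : ℝ} (hb : 0 < b) (n : ℕ) :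
    Integrable fun x : ℝ => x ^ n * Real.exp (-b * x ^ 2) := by
  have := integrable_rpow_mul_exp_neg_mul_sq hb (s := n)
    (by have : (0:ℝ) ≤ n := n.cast_nonneg
        linarith)
  simpa using this

theorem contDiff_exp_neg_sq : ContDiff ℝ ⊤ fun t : ℝ => Real.exp (-t ^ 2) := by fun_prop

theorem exp_neg_sq_mul_hermiteH (b : ℝ) (j : ℕ) :
    ((Real.exp (-b ^ 2) * hermiteH j b : ℝ) : ℂ) =
      Real.sqrt π * ∫ v : ℝ, Complex.exp ((-2 * π * v * b : ℝ) * Complex.I) *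
        ((2 * π * Complex.I * v) ^ j * Real.exp (-π ^ 2 * v ^ 2)) := by
  have hF : (fun t : ℝ => ((Real.exp (-t ^ 2) : ℝ) : ℂ)) =
      (Real.sqrt π : ℂ) • 𝓕 fun x : ℝ => Complex.exp (-π * π * x ^ 2) := by
    rw [fourier_gaussian_pi (by simpa using pi_pos)]
    ext t
    have hpi : (π : ℂ) ≠ 0 := by exact_mod_cast pi_ne_zero
    have hsq : (π : ℂ) ^ (1 / 2 : ℂ) = (Real.sqrt π : ℂ) := by
      rw [Real.sqrt_eq_rpow, Complex.ofReal_cpow pi_pos.le]; norm_num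
    have hs : (Real.sqrt π : ℂ) ≠ 0 := by exact_mod_cast (Real.sqrt_pos.mpr pi_pos).ne'
    simp only [Pi.smul_apply, smul_eq_mul, hsq]
    rw [← mul_assoc, mul_one_div_cancel hs, one_mul, neg_div, div_self hpi]
    push_cast
    congr 1; ring
  have hint : ∀ n : ℕ, (n : ℕ∞) ≤ ⊤ →
      Integrable fun x : ℝ => x ^ n • Complex.exp (-π * π * x ^ 2) := by
    intro n _
    convert! (integrable_pow_mul_exp_neg_mul_sq (b := π * π) (by positivity) n).ofReal (𝕜 := ℂ)
      using 2 with x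
    simp
  have hD := congrFun (iteratedDeriv_ofReal contDiff_exp_neg_sq j) b
  rw [hF, iteratedDeriv_const_smul_field, Real.iteratedDeriv_fourier hint le_top] at hD
  simp only [Real.fourier_real_eq_integral_exp_smul, smul_eq_mul] at hD
  have he : Real.exp (-b ^ 2) * hermiteH j b =
      (-1) ^ j * iteratedDeriv j (fun t : ℝ => Real.exp (-t ^ 2)) b := by
    have : Real.exp (-b ^ 2) * Real.exp (b ^ 2) = 1 := by rw [← Real.exp_add]; simp
    rw [hermiteH]
    linear_combination ((-1) ^ j * iteratedDeriv j (fun t : ℝ => Real.exp (-t ^ 2)) b) * this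
  rw [he, Complex.ofReal_mul, ← hD, mul_left_comm, ← integral_const_mul]
  congr 2
  ext v
  rw [mul_left_comm]
  push_cast
  have : (2 * π * Complex.I * v) ^ j = (-1) ^ j * (-2 * π * Complex.I * v : ℂ) ^ j := by
    rw [← mul_pow]; congr 1; ring
  rw [this]
  ring_nf

theorem integrable_exp_abs_mul_exp_neg_mul_sq (p : ℝ) {q c : ℝ} (h : q < c) :
    Integrable fun v : ℝ => Real.exp (p * |v| + q * v ^ 2) * Real.exp (-c * v ^ 2) := by
  have hd : 0 < (c - q) / 2 := by linarith
  refine ((integrable_exp_neg_mul_sq hd).const_mul (Real.exp (p ^ 2 / (2 * (c - q))))).mono'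
    (by fun_prop) (Filter.Eventually.of_forall fun v => ?_)
  rw [← Real.exp_add, ← Real.exp_add, Real.norm_eq_abs, Real.abs_exp, Real.exp_le_exp]
  have hcq : 0 < c - q := by linarith
  have key : p * |v| ≤ p ^ 2 / (2 * (c - q)) + (c - q) / 2 * v ^ 2 := by
    rw [← sub_nonneg]
    have : p ^ 2 / (2 * (c - q)) + (c - q) / 2 * v ^ 2 - p * |v| =
        (p - (c - q) * |v|) ^ 2 / (2 * (c - q)) := by
      rw [← sq_abs v]
      field_simp
      ring
    rw [this]
    positivity
  linarith

theorem expQuadCoeff_nonneg {p q : ℝ} (hp : 0 ≤ p) (hq : 0 ≤ q) (j : ℕ) :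
    0 ≤ expQuadCoeff p q j :=
  Finset.sum_nonneg fun kl _ => by split_ifs <;> positivity

theorem hasSum_expQuadCoeff_mul_exp {p q r : ℝ} (c v : ℝ) :
    HasSum (fun j : ℕ => expQuadCoeff p q j * r ^ j * (|v| ^ j * Real.exp (-c * v ^ 2)))
      (Real.exp (p * r * |v| + q * r ^ 2 * v ^ 2) * Real.exp (-c * v ^ 2)) := by
  have h := (hasSum_expQuadCoeff p q (r * |v|)).mul_right (Real.exp (-c * v ^ 2))
  rw [← Real.exp_eq_exp_ℝ] at h
  convert! h using 1
  · ext j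
    simp only [RCLike.ofReal_real_eq_id, id]
    ring
  · simp only [RCLike.ofReal_real_eq_id, id, mul_pow, sq_abs]
    ring_nf

theorem summable_expQuadCoeff_mul_moment {p q r c : ℝ} (hp : 0 ≤ p) (hq : 0 ≤ q) (hr : 0 ≤ r)
    (h : q * r ^ 2 < c) :
    Summable fun j : ℕ =>
      expQuadCoeff p q j * r ^ j * ∫ v : ℝ, |v| ^ j * Real.exp (-c * v ^ 2) := by
  simp only [← integral_const_mul]
  refine (hasSum_integral_of_dominated_convergence
    (fun j v => expQuadCoeff p q j * r ^ j * (|v| ^ j * Real.exp (-c * v ^ 2)))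
    (fun j => by fun_prop) (fun j => Filter.Eventually.of_forall fun v => ?_)
    (Filter.Eventually.of_forall fun v => (hasSum_expQuadCoeff_mul_exp c v).summable) ?_
    (Filter.Eventually.of_forall fun v => hasSum_expQuadCoeff_mul_exp c v)).summable
  · have := expQuadCoeff_nonneg hp hq j
    rw [Real.norm_of_nonneg (by positivity)]
  · simp only [(hasSum_expQuadCoeff_mul_exp c _).tsum_eq]
    exact integrable_exp_abs_mul_exp_neg_mul_sq _ h

theorem abs_exp_neg_sq_mul_hermiteH_le (b : ℝ) (j : ℕ) :
    |Real.exp (-b ^ 2) * hermiteH j b| ≤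
      Real.sqrt π * ((2 * π) ^ j * ∫ v : ℝ, |v| ^ j * Real.exp (-π ^ 2 * v ^ 2)) := by
  rw [← Real.norm_eq_abs, ← Complex.norm_real, exp_neg_sq_mul_hermiteH, norm_mul,
    Complex.norm_real, Real.norm_of_nonneg (Real.sqrt_nonneg _), ← integral_const_mul]
  gcongr
  refine (norm_integral_le_integral_norm _).trans (le_of_eq (integral_congr_ae ?_))
  refine Filter.Eventually.of_forall fun v => ?_
  simp only [norm_mul, Complex.norm_exp_ofReal_mul_I, norm_pow, Complex.norm_real,
    Complex.norm_I, Real.norm_eq_abs, Real.abs_exp, abs_of_pos pi_pos, Complex.norm_ofNat]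
  ring

/-- Mehler's formula. -/
theorem hasSum_mehler {ρ : ℝ} (hρ : 0 ≤ ρ) (hρ' : ρ < 1) (a b : ℝ) :
    HasSum (fun j : ℕ => (ρ / 2) ^ j / j.factorial * hermiteH j a *
        (Real.exp (-b ^ 2) * hermiteH j b))
      (1 / Real.sqrt (1 - ρ ^ 2) * Real.exp (-(b - a * ρ) ^ 2 / (1 - ρ ^ 2))) := by
  have hρ2 : 0 < 1 - ρ ^ 2 := by nlinarith
  have hlt : |(-1 : ℝ)| * (π * ρ) ^ 2 < π ^ 2 := by
    have : 0 < π ^ 2 * (1 - ρ ^ 2) := by positivity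
    simp only [abs_neg, abs_one]
    linarith
  have hpi : (π : ℂ) ≠ 0 := by exact_mod_cast pi_ne_zero
  rw [← Complex.hasSum_ofReal]
  have hlim : ∀ v : ℝ, HasSum (fun j : ℕ => Complex.exp ((-2 * π * v * b : ℝ) * Complex.I) *
      ((expQuadCoeff (2 * a) (-1) j : ℂ) * (π * ρ * Complex.I * v) ^ j *
        Real.exp (-π ^ 2 * v ^ 2)))
      (Complex.exp ((-2 * π * v * (b - a * ρ) : ℝ) * Complex.I) •
        Complex.exp (-π * (π * (1 - ρ ^ 2) : ℝ) * v ^ 2)) := by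
    intro v
    have h := ((hasSum_expQuadCoeff (2 * a) (-1) (π * ρ * Complex.I * v : ℂ)).mul_right
      (Real.exp (-π ^ 2 * v ^ 2) : ℂ)).mul_left (Complex.exp ((-2 * π * v * b : ℝ) * Complex.I))
    rw [← Complex.exp_eq_exp_ℂ] at h
    convert! h using 1
    simp only [smul_eq_mul, Complex.ofReal_exp, ← Complex.exp_add]
    congr 1
    simp
    linear_combination (π ^ 2 * ρ ^ 2 * v ^ 2 : ℂ) * Complex.I_sq
  have h := (hasSum_integral_of_dominated_convergence (μ := volume)
    (fun j v => expQuadCoeff |2 * a| |-1| j * (π * ρ) ^ j *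
      (|v| ^ j * Real.exp (-π ^ 2 * v ^ 2)))
    (fun j => by fun_prop) (fun j => Filter.Eventually.of_forall fun v => ?_)
    (Filter.Eventually.of_forall fun v => (hasSum_expQuadCoeff_mul_exp _ v).summable) ?_
    (Filter.Eventually.of_forall hlim)).mul_left (Real.sqrt π : ℂ)
  · convert! h using 1
    · ext j
      rw [Complex.ofReal_mul, exp_neg_sq_mul_hermiteH, mul_left_comm, ← integral_const_mul]
      congr 2
      ext v
      have hj : (j.factorial : ℂ) ≠ 0 := by exact_mod_cast j.factorial_ne_zero
      have hpow : (π * ρ * Complex.I * v : ℂ) ^ j =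
          (ρ / 2) ^ j * (2 * π * Complex.I * v) ^ j := by
        rw [← mul_pow]; congr 1; ring
      rw [hermiteH_eq, hpow]
      push_cast
      field_simp
    · rw [← Real.fourier_real_eq_integral_exp_smul, fourier_gaussian_pi
        (by rw [Complex.ofReal_re]; positivity)]
      have hsq : ((π * (1 - ρ ^ 2) : ℝ) : ℂ) ^ (1 / 2 : ℂ) =
          (Real.sqrt π * Real.sqrt (1 - ρ ^ 2) : ℝ) := by
        rw [← Real.sqrt_mul pi_pos.le, Real.sqrt_eq_rpow,
          Complex.ofReal_cpow (by positivity)]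
        norm_num
      have h₁ : (Real.sqrt π : ℂ) ≠ 0 := by exact_mod_cast (Real.sqrt_pos.mpr pi_pos).ne'
      have h₂ : (Real.sqrt (1 - ρ ^ 2) : ℂ) ≠ 0 := by exact_mod_cast (Real.sqrt_pos.mpr hρ2).ne'
      have h₃ : (1 - ρ ^ 2 : ℂ) ≠ 0 := by exact_mod_cast hρ2.ne'
      rw [hsq]
      push_cast
      rw [show -(b - a * ρ : ℂ) ^ 2 / (1 - ρ ^ 2) =
        -π / (π * (1 - ρ ^ 2)) * (b - a * ρ) ^ 2 by field_simp]
      field_simp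
  · simp only [norm_mul, Complex.norm_exp_ofReal_mul_I, norm_pow, Complex.norm_real,
      Complex.norm_I, Real.norm_eq_abs, Real.abs_exp, abs_of_pos pi_pos, abs_of_nonneg hρ]
    rw [one_mul, mul_one, mul_pow _ |v|, ← mul_assoc, ← mul_assoc]
    gcongr
    exact abs_expQuadCoeff_le _ _ _
  · simp only [(hasSum_expQuadCoeff_mul_exp _ _).tsum_eq]
    exact integrable_exp_abs_mul_exp_neg_mul_sq _ hlt

theorem continuous_hermiteH (j : ℕ) : Continuous (hermiteH j) := by
  have := contDiff_exp_neg_sq.continuous_iteratedDeriv j (by exact_mod_cast le_top)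
  unfold hermiteH
  fun_prop

theorem hasSum_integral_mehler {ρ : ℝ} (hρ : 0 ≤ ρ) (hρ' : ρ < 1) (a : ℝ) {b g : ℝ → ℝ}
    (hb : Continuous b) (hg : Integrable g) :
    HasSum (fun j : ℕ => ∫ ξ, (ρ / 2) ^ j / j.factorial * hermiteH j a *
        (Real.exp (-b ξ ^ 2) * hermiteH j (b ξ)) * g ξ)
      (∫ ξ, 1 / Real.sqrt (1 - ρ ^ 2) * Real.exp (-(b ξ - a * ρ) ^ 2 / (1 - ρ ^ 2)) * g ξ) := by
  have hlt : |(-1 : ℝ)| * (π * ρ) ^ 2 < π ^ 2 := by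
    have : 0 < π ^ 2 * (1 - ρ ^ 2) := mul_pos (by positivity) (by nlinarith)
    simp only [abs_neg, abs_one]
    linarith
  set m : ℕ → ℝ := fun j => expQuadCoeff |2 * a| |-1| j * (π * ρ) ^ j *
    ∫ v : ℝ, |v| ^ j * Real.exp (-π ^ 2 * v ^ 2) with hm
  have hsum : Summable m :=
    summable_expQuadCoeff_mul_moment (abs_nonneg _) (abs_nonneg _) (by positivity) hlt
  refine hasSum_integral_of_dominated_convergence (fun j ξ => Real.sqrt π * m j * |g ξ|)
    (fun j => ?_) (fun j => Filter.Eventually.of_forall fun ξ => ?_)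
    (Filter.Eventually.of_forall fun ξ => (hsum.mul_left _).mul_right _) ?_
    (Filter.Eventually.of_forall fun ξ => (hasSum_mehler hρ hρ' a (b ξ)).mul_right _)
  · have := continuous_hermiteH j
    exact (Continuous.aestronglyMeasurable (by fun_prop)).mul hg.aestronglyMeasurable
  · rw [norm_mul, Real.norm_eq_abs (g ξ)]
    refine mul_le_mul_of_nonneg_right ?_ (abs_nonneg _)
    have hj : (j.factorial : ℝ) ≠ 0 := by exact_mod_cast j.factorial_ne_zero
    have hc : (ρ / 2) ^ j / j.factorial * hermiteH j a =
        expQuadCoeff (2 * a) (-1) j * (ρ / 2) ^ j := by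
      rw [hermiteH_eq]; field_simp
    rw [hc, norm_mul, norm_mul, Real.norm_of_nonneg (by positivity : 0 ≤ (ρ / 2) ^ j)]
    refine (mul_le_mul (mul_le_mul_of_nonneg_right (abs_expQuadCoeff_le (2 * a) (-1) j)
      (by positivity)) (abs_exp_neg_sq_mul_hermiteH_le (b ξ) j) (abs_nonneg _) ?_).trans_eq ?_
    · exact mul_nonneg (expQuadCoeff_nonneg (abs_nonneg _) (abs_nonneg _) j) (by positivity)
    · simp only [hm]
      rw [show π * ρ = ρ / 2 * (2 * π) by ring, mul_pow (ρ / 2)]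
      ring
  · simp only [tsum_mul_right]
    exact hg.abs.const_mul _

theorem heat_solution_hermite_series' (f : ℝ → ℝ) (hf : Continuous f)
    (hsupp : HasCompactSupport f) (τ β : ℝ) (hτ : 0 < τ) (hβ : 0 < β)
    (u : ℝ → ℝ)
    (hu : ∀ x : ℝ, u x =
      (1 / (2 * Real.sqrt (Real.pi * τ))) * ∫ ξ : ℝ, Real.exp (-(x - ξ) ^ 2 / (4 * τ)) * f ξ)
    (x : ℝ) :
    HasSum
      (fun j : ℕ =>
        (1 / (2 * Real.sqrt (τ + β))) ^ j * hermiteH j (x / (2 * Real.sqrt β)) *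
          (β ^ ((j : ℝ) / 2) / (j.factorial : ℝ)) *
          ∫ ξ : ℝ,
            Real.exp (-ξ ^ 2 / (4 * (τ + β))) / (2 * Real.sqrt (Real.pi * (τ + β))) *
              hermiteH j (ξ / (2 * Real.sqrt (τ + β))) * f ξ)
      (u x) := by
  have hτβ : 0 < τ + β := by positivity
  have hsβ := Real.sqrt_pos.mpr hβ
  have hsτβ := Real.sqrt_pos.mpr hτβ
  have hsτ := Real.sqrt_pos.mpr hτ
  have hsπ := Real.sqrt_pos.mpr pi_pos
  have hqβ := Real.sq_sqrt hβ.le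
  have hqτβ := Real.sq_sqrt hτβ.le
  have hρ : 0 ≤ Real.sqrt β / Real.sqrt (τ + β) := by positivity
  have hρ' : Real.sqrt β / Real.sqrt (τ + β) < 1 := by
    rw [div_lt_one hsτβ]
    exact Real.sqrt_lt_sqrt hβ.le (by linarith)
  have h1ρ : 1 - (Real.sqrt β / Real.sqrt (τ + β)) ^ 2 = τ / (τ + β) := by
    rw [div_pow, hqβ, hqτβ]; field_simp; ring
  have h := (hasSum_integral_mehler hρ hρ' (x / (2 * Real.sqrt β))
    (b := fun ξ => ξ / (2 * Real.sqrt (τ + β))) (by fun_prop)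
    (hf.integrable_of_hasCompactSupport hsupp)).mul_left (1 / (2 * Real.sqrt (π * (τ + β))))
  simp only [← integral_const_mul] at h
  rw [hu, ← integral_const_mul]
  simp only [← integral_const_mul]
  convert! h using 1
  · ext j
    congr 1
    ext ξ
    have hpow : β ^ ((j : ℝ) / 2) = Real.sqrt β ^ j := by
      rw [Real.sqrt_eq_rpow, ← Real.rpow_mul_natCast hβ.le]; ring_nf
    have he : -(ξ / (2 * Real.sqrt (τ + β))) ^ 2 = -ξ ^ 2 / (4 * (τ + β)) := by
      rw [div_pow, mul_pow, hqτβ]; ring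
    rw [hpow, he]
    simp only [div_pow, mul_pow, one_pow]
    field_simp
  · congr 1
    ext ξ
    have he : -(ξ / (2 * Real.sqrt (τ + β)) -
        x / (2 * Real.sqrt β) * (Real.sqrt β / Real.sqrt (τ + β))) ^ 2 / (τ / (τ + β)) =
        -(x - ξ) ^ 2 / (4 * τ) := by
      rw [show ξ / (2 * Real.sqrt (τ + β)) -
        x / (2 * Real.sqrt β) * (Real.sqrt β / Real.sqrt (τ + β)) =
        (ξ - x) / (2 * Real.sqrt (τ + β)) by field_simp, div_pow, mul_pow, hqτβ]
      field_simp
      ring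
    rw [h1ρ, he, Real.sqrt_mul pi_pos.le, Real.sqrt_mul pi_pos.le, Real.sqrt_div hτ.le]
    field_simp
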